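/- arXiv:1908.08069 — 2 statements merged into one kernel-verified Lean document; each statement's English description precedes it below -/
import Mathlib

section
/- Call a Borel probability measure v on U(N) universal if for every nonempty open ball B ⊆ U(N) there exists k ∈ ℕ with v^{*k}(B) > 0. If v is universal, then for every t ∈ ℕ the eigenvalue-1 eigenspace of M_{v,t} equals the simultaneous fixed space {ψ ∈ ℂ^{N^{2t}} : U^{⊗t,t} ψ = ψ for all U ∈ U(N)}, which is the eigenvalue-1 eigenspace of M_{μ,t} for the Haar measure μ. -/
open MeasureTheory Matrix Finset
open scoped Real ComplexConjugate ComplexOrder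

noncomputable section

instance {m n α : Type*} [MeasurableSpace α] : MeasurableSpace (Matrix m n α) :=
  inferInstanceAs (MeasurableSpace (m → n → α))

/-- The operator (spectral) norm of a complex matrix, i.e. the norm of the induced
linear map between Euclidean spaces. -/
def opNorm {m n : Type*} [Fintype m] [Fintype n] [DecidableEq n] (A : Matrix m n ℂ) : ℝ :=
  ‖LinearMap.toContinuousLinearMap (Matrix.toEuclideanLin A)‖

/-- `U^{⊗t}` as a matrix, entrywise. -/
def tpow {d : Type*} [Fintype d] (t : ℕ) (U : Matrix d d ℂ) :
    Matrix (Fin t → d) (Fin t → d) ℂ :=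
  Matrix.of fun x y => ∏ i, U (x i) (y i)

/-- `U^{⊗t,t} = U^{⊗t} ⊗ (conj U)^{⊗t}` as a matrix, entrywise. -/
def tpow2 {d : Type*} [Fintype d] (t : ℕ) (U : Matrix d d ℂ) :
    Matrix ((Fin t → d) × (Fin t → d)) ((Fin t → d) × (Fin t → d)) ℂ :=
  Matrix.of fun x y => (∏ i, U (x.1 i) (y.1 i)) * ∏ i, conj (U (x.2 i) (y.2 i))

/-- The moment matrix `M_{v,t} = ∫ U^{⊗t,t} dv(U)` of a measure on the unitary group,
defined entrywise. -/
def Mmat {d : Type*} [Fintype d] [DecidableEq d]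
    (v : Measure (Matrix.unitaryGroup d ℂ)) (t : ℕ) :
    Matrix ((Fin t → d) × (Fin t → d)) ((Fin t → d) × (Fin t → d)) ℂ :=
  Matrix.of fun x y => ∫ U, tpow2 t (U : Matrix d d ℂ) x y ∂v

/-- `g(v,t) = ‖M_{v,t} - M_{μ,t}‖` where `μ` is the Haar measure. -/
def gfun {d : Type*} [Fintype d] [DecidableEq d]
    (μ v : Measure (Matrix.unitaryGroup d ℂ)) (t : ℕ) : ℝ :=
  opNorm (Mmat v t - Mmat μ t)

/-- Multiplicative convolution of measures on a monoid: the law of a product of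
independent random variables. -/
def mconv {G : Type*} [Monoid G] [MeasurableSpace G] (v w : Measure G) : Measure G :=
  Measure.map (fun p : G × G => p.1 * p.2) (v.prod w)

/-- `convPow v k` is the `k`-fold convolution `v^{*k}`, the law of a product of `k`
independent random variables with law `v`. -/
def convPow {G : Type*} [Monoid G] [MeasurableSpace G] (v : Measure G) : ℕ → Measure G
  | 0 => Measure.dirac 1
  | k + 1 => mconv v (convPow v k)

section TensorPower

variable {d : Type*} [Fintype d]

theorem tpow2_mul (t : ℕ) (U W : Matrix d d ℂ) : tpow2 t (U * W) = tpow2 t U * tpow2 t W := by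
  classical
  ext x y
  simp only [tpow2, Matrix.of_apply, Matrix.mul_apply, map_sum, map_mul, Finset.prod_univ_sum,
    Fintype.piFinset_univ, Fintype.sum_prod_type, Finset.prod_mul_distrib, Finset.sum_mul_sum]
  refine Finset.sum_congr rfl fun a _ => Finset.sum_congr rfl fun b _ => ?_
  ring

theorem tpow2_one [DecidableEq d] (t : ℕ) : tpow2 t (1 : Matrix d d ℂ) = 1 := by
  have key (a b : Fin t → d) : ∏ i, (1 : Matrix d d ℂ) (a i) (b i) = if a = b then 1 else 0 := by
    simp only [Matrix.one_apply, Finset.prod_ite_zero, Finset.prod_const_one, funext_iff,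
      Finset.mem_univ, true_imp_iff]
  ext x y
  simp only [tpow2, Matrix.of_apply, ← map_prod, key]
  simp only [Matrix.one_apply, Prod.ext_iff]
  split_ifs <;> simp_all

theorem tpow2_conjTranspose (t : ℕ) (U : Matrix d d ℂ) : tpow2 t Uᴴ = (tpow2 t U)ᴴ := by
  ext x y
  simp [tpow2, Matrix.conjTranspose_apply]

variable [DecidableEq d]

theorem sum_normSq_tpow2_mulVec (t : ℕ) (U : Matrix.unitaryGroup d ℂ)
    (ψ : ((Fin t → d) × (Fin t → d)) → ℂ) :
    ∑ x, Complex.normSq ((tpow2 t (U : Matrix d d ℂ) *ᵥ ψ) x) = ∑ x, Complex.normSq (ψ x) := by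
  have hU : (tpow2 t (U : Matrix d d ℂ))ᴴ * tpow2 t (U : Matrix d d ℂ) = 1 := by
    rw [← tpow2_conjTranspose, ← tpow2_mul, ← Matrix.star_eq_conjTranspose,
      Matrix.UnitaryGroup.star_mul_self, tpow2_one]
  have h : star (tpow2 t (U : Matrix d d ℂ) *ᵥ ψ) ⬝ᵥ (tpow2 t (U : Matrix d d ℂ) *ᵥ ψ)
      = star ψ ⬝ᵥ ψ := by
    rw [Matrix.star_mulVec, Matrix.dotProduct_mulVec, Matrix.vecMul_vecMul, hU, Matrix.vecMul_one]
  apply Complex.ofReal_injective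
  simpa [dotProduct, Complex.normSq_eq_conj_mul_self] using h

theorem continuous_tpow2 (t : ℕ) :
    Continuous fun U : Matrix.unitaryGroup d ℂ => tpow2 t (U : Matrix d d ℂ) := by
  refine continuous_matrix fun x y => ?_
  have h (a b : d) : Continuous fun U : Matrix.unitaryGroup d ℂ => (U : Matrix d d ℂ) a b :=
    continuous_subtype_val.matrix_elem a b
  simp only [tpow2, Matrix.of_apply]
  exact (continuous_finsetProd _ fun i _ => h _ _).mul
    (continuous_finsetProd _ fun i _ => Complex.continuous_conj.comp (h _ _))

theorem isClosed_setOf_tpow2_mulVec_eq (t : ℕ) (ψ : ((Fin t → d) × (Fin t → d)) → ℂ) :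
    IsClosed {U : Matrix.unitaryGroup d ℂ | tpow2 t (U : Matrix d d ℂ) *ᵥ ψ = ψ} :=
  isClosed_eq ((continuous_tpow2 t).matrix_mulVec continuous_const) continuous_const

theorem norm_tpow2_apply_le (t : ℕ) (U : Matrix.unitaryGroup d ℂ)
    (x y : (Fin t → d) × (Fin t → d)) : ‖tpow2 t (U : Matrix d d ℂ) x y‖ ≤ 1 := by
  have h (a b : Fin t → d) : ∏ i, ‖(U : Matrix d d ℂ) (a i) (b i)‖ ≤ 1 :=
    Finset.prod_le_one (fun _ _ => norm_nonneg _) fun _ _ =>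
      entry_norm_bound_of_unitary U.2 _ _
  simp only [tpow2, Matrix.of_apply, norm_mul, norm_prod, RCLike.norm_conj]
  exact mul_le_one₀ (h _ _) (Finset.prod_nonneg fun _ _ => norm_nonneg _) (h _ _)

instance : BorelSpace (Matrix d d ℂ) := inferInstanceAs (BorelSpace (d → d → ℂ))

instance : SecondCountableTopology (Matrix d d ℂ) :=
  inferInstanceAs (SecondCountableTopology (d → d → ℂ))

instance : BorelSpace (Matrix.unitaryGroup d ℂ) :=
  Subtype.borelSpace (α := Matrix d d ℂ) _

instance : SecondCountableTopology (Matrix.unitaryGroup d ℂ) :=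
  TopologicalSpace.Subtype.secondCountableTopology (α := Matrix d d ℂ) _

variable (v : Measure (Matrix.unitaryGroup d ℂ)) [IsProbabilityMeasure v]

theorem integrable_tpow2_apply (t : ℕ) (x y : (Fin t → d) × (Fin t → d)) :
    Integrable (fun U : Matrix.unitaryGroup d ℂ => tpow2 t (U : Matrix d d ℂ) x y) v :=
  .of_bound ((continuous_tpow2 t).matrix_elem x y).aestronglyMeasurable 1
    (.of_forall fun U => norm_tpow2_apply_le t U x y)

theorem integrable_tpow2_mulVec_apply (t : ℕ) (ψ : ((Fin t → d) × (Fin t → d)) → ℂ)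
    (x : (Fin t → d) × (Fin t → d)) :
    Integrable (fun U : Matrix.unitaryGroup d ℂ => (tpow2 t (U : Matrix d d ℂ) *ᵥ ψ) x) v :=
  integrable_finsetSum _ fun y _ => (integrable_tpow2_apply v t x y).mul_const _

theorem Mmat_mulVec_apply (t : ℕ) (ψ : ((Fin t → d) × (Fin t → d)) → ℂ)
    (x : (Fin t → d) × (Fin t → d)) :
    (Mmat v t *ᵥ ψ) x = ∫ U, (tpow2 t (U : Matrix d d ℂ) *ᵥ ψ) x ∂v := by
  simp only [Matrix.mulVec, dotProduct, Mmat, Matrix.of_apply]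
  rw [integral_finsetSum _ fun y _ => (integrable_tpow2_apply v t x y).mul_const _]
  simp only [integral_mul_const]

theorem Mmat_mulVec_eq_self_of_forall {t : ℕ} {ψ : ((Fin t → d) × (Fin t → d)) → ℂ}
    (h : ∀ U : Matrix.unitaryGroup d ℂ, tpow2 t (U : Matrix d d ℂ) *ᵥ ψ = ψ) :
    Mmat v t *ᵥ ψ = ψ := by
  ext x
  simp [Mmat_mulVec_apply, h]

theorem tpow2_mul_Mmat_of_isMulLeftInvariant [v.IsMulLeftInvariant] (t : ℕ)
    (W : Matrix.unitaryGroup d ℂ) : tpow2 t (W : Matrix d d ℂ) * Mmat v t = Mmat v t := by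
  ext x y
  simp only [Matrix.mul_apply, Mmat, Matrix.of_apply, ← integral_const_mul]
  rw [← integral_finsetSum _ fun z _ => (integrable_tpow2_apply v t z y).const_mul _,
    ← integral_mul_left_eq_self (fun U : Matrix.unitaryGroup d ℂ => tpow2 t (U : Matrix d d ℂ) x y)
      W]
  simp only [Matrix.UnitaryGroup.mul_val, tpow2_mul, Matrix.mul_apply]

/-- A vector fixed by an average of unitaries is fixed by almost all of them. -/
theorem ae_tpow2_mulVec_eq_self {t : ℕ} {ψ : ((Fin t → d) × (Fin t → d)) → ℂ}
    (h : Mmat v t *ᵥ ψ = ψ) :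
    ∀ᵐ U : Matrix.unitaryGroup d ℂ ∂v, tpow2 t (U : Matrix d d ℂ) *ᵥ ψ = ψ := by
  let g : Matrix.unitaryGroup d ℂ → ℝ := fun U =>
    ∑ x, Complex.normSq ((tpow2 t (U : Matrix d d ℂ) *ᵥ ψ) x - ψ x)
  have hg (U) : g U = ∑ x, 2 * Complex.normSq (ψ x)
      - ∑ x, 2 * ((tpow2 t (U : Matrix d d ℂ) *ᵥ ψ) x * conj (ψ x)).re := by
    simp only [g, Complex.normSq_sub, Finset.sum_sub_distrib, Finset.sum_add_distrib,
      sum_normSq_tpow2_mulVec, ← Finset.mul_sum]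
    ring
  have hintMul (x) : Integrable (fun U : Matrix.unitaryGroup d ℂ =>
      (tpow2 t (U : Matrix d d ℂ) *ᵥ ψ) x * conj (ψ x)) v :=
    (integrable_tpow2_mulVec_apply v t ψ x).mul_const _
  have hintRe (x) : Integrable (fun U : Matrix.unitaryGroup d ℂ =>
      2 * ((tpow2 t (U : Matrix d d ℂ) *ᵥ ψ) x * conj (ψ x)).re) v :=
    (hintMul x).re.const_mul _
  have hre (x) : ∫ U : Matrix.unitaryGroup d ℂ,
      ((tpow2 t (U : Matrix d d ℂ) *ᵥ ψ) x * conj (ψ x)).re ∂v = Complex.normSq (ψ x) := by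
    refine (integral_re (hintMul x)).trans ?_
    rw [integral_mul_const (μ := v), ← Mmat_mulVec_apply, h, Complex.mul_conj]
    exact Complex.ofReal_re _
  have hgint : Integrable g v := by
    rw [funext hg]
    exact (integrable_const _).sub (integrable_finsetSum _ fun x _ => hintRe x)
  have hg0 : ∫ U, g U ∂v = 0 := by
    simp only [hg]
    rw [integral_sub (integrable_const _) (integrable_finsetSum _ fun x _ => hintRe x),
      integral_finsetSum _ fun x _ => hintRe x]
    simp only [integral_const_mul, hre, integral_const, probReal_univ, one_smul, sub_self]
  have hgnn : 0 ≤ g := fun U => Finset.sum_nonneg fun x _ => Complex.normSq_nonneg _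
  filter_upwards [(integral_eq_zero_iff_of_nonneg hgnn hgint).1 hg0] with U hU
  ext x
  have := (Finset.sum_eq_zero_iff_of_nonneg fun x _ => Complex.normSq_nonneg _).1 hU x
    (Finset.mem_univ x)
  exact sub_eq_zero.1 (Complex.normSq_eq_zero.1 this)

end TensorPower

section Convolution

variable {G : Type*} [Monoid G] [MeasurableSpace G]

theorem sfinite_convPow (v : Measure G) [SFinite v] (k : ℕ) : SFinite (convPow v k) := by
  induction k with
  | zero => unfold convPow; infer_instance
  | succ k ih => unfold convPow mconv; infer_instance

/-- Convolution powers of a measure concentrated on a submonoid are concentrated on it. -/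
theorem ae_mem_convPow [MeasurableMul₂ G] {v : Measure G} [SFinite v] {S : Submonoid G}
    (hS : MeasurableSet (S : Set G)) (h : ∀ᵐ g ∂v, g ∈ S) (k : ℕ) :
    ∀ᵐ g ∂convPow v k, g ∈ S := by
  induction k with
  | zero => exact (ae_dirac_iff hS).2 S.one_mem
  | succ k ih =>
    have := sfinite_convPow v k
    refine (ae_map_iff measurable_mul.aemeasurable hS).2 ?_
    filter_upwards [Measure.quasiMeasurePreserving_fst.ae h,
      Measure.quasiMeasurePreserving_snd.ae ih] with p h₁ h₂
    exact S.mul_mem h₁ h₂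

end Convolution

/-- **Fixed spaces of universal measures.** If `v` is universal (every nonempty open
set receives positive mass under some convolution power `v^{*k}`), then the
eigenvalue-1 eigenspace of `M_{v,t}` equals the simultaneous fixed space
`{ψ : U^{⊗t,t}ψ = ψ for all U ∈ U(N)}`, which is also the eigenvalue-1 eigenspace of
the Haar moment matrix `M_{μ,t}`. -/
theorem universal_fixed_space {N : ℕ} (hN : 1 ≤ N)
    (μ v : Measure (Matrix.unitaryGroup (Fin N) ℂ))
    [IsProbabilityMeasure μ] [μ.IsMulLeftInvariant] [IsProbabilityMeasure v]
    (huniv : ∀ O : Set (Matrix.unitaryGroup (Fin N) ℂ), IsOpen O → O.Nonempty →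
      ∃ k : ℕ, 0 < convPow v k O)
    (t : ℕ) :
    {ψ : ((Fin t → Fin N) × (Fin t → Fin N)) → ℂ | (Mmat v t).mulVec ψ = ψ} =
        {ψ | ∀ U : Matrix.unitaryGroup (Fin N) ℂ,
          (tpow2 t (U : Matrix (Fin N) (Fin N) ℂ)).mulVec ψ = ψ} ∧
    {ψ : ((Fin t → Fin N) × (Fin t → Fin N)) → ℂ | (Mmat μ t).mulVec ψ = ψ} =
        {ψ | ∀ U : Matrix.unitaryGroup (Fin N) ℂ,
          (tpow2 t (U : Matrix (Fin N) (Fin N) ℂ)).mulVec ψ = ψ} := by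
  refine ⟨Set.Subset.antisymm (fun ψ hψ => ?_) fun ψ => Mmat_mulVec_eq_self_of_forall v,
    Set.Subset.antisymm (fun ψ hψ U => ?_) fun ψ => Mmat_mulVec_eq_self_of_forall μ⟩
  · let S : Submonoid (Matrix.unitaryGroup (Fin N) ℂ) :=
      { carrier := {U | tpow2 t (U : Matrix (Fin N) (Fin N) ℂ) *ᵥ ψ = ψ}
        one_mem' := by simp [tpow2_one]
        mul_mem' := fun {U W} (hU : _ = ψ) (hW : _ = ψ) => by
          simp only [Set.mem_ofPred_eq, Matrix.UnitaryGroup.mul_val, tpow2_mul,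
            ← Matrix.mulVec_mulVec, hW, hU] }
    have hS : IsClosed (S : Set (Matrix.unitaryGroup (Fin N) ℂ)) :=
      isClosed_setOf_tpow2_mulVec_eq t ψ
    by_contra hne
    obtain ⟨U, hU⟩ := not_forall.1 hne
    obtain ⟨k, hk⟩ := huniv (S : Set (Matrix.unitaryGroup (Fin N) ℂ))ᶜ hS.isOpen_compl ⟨U, hU⟩
    exact hk.ne' (ae_mem_convPow hS.measurableSet (ae_tpow2_mulVec_eq_self v hψ) k)
  · change Mmat μ t *ᵥ ψ = ψ at hψ
    rw [← hψ, Matrix.mulVec_mulVec, tpow2_mul_Mmat_of_isMulLeftInvariant]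
end
end

section
/- (Hiding property.) For every n ≥ 2, m ≥ 2, and every output string y ∈ {0,1}^n, the real random variable β ↦ |⟨y| U_β^m |+^n⟩|² (with β uniform on [0,2π)^{n×(m−1)}) has the same probability distribution as the random variable β ↦ |⟨0^n| U_β^m |+^n⟩|². -/
open MeasureTheory Matrix Finset
open scoped Real ComplexConjugate ComplexOrder

noncomputable section

/-- The matrix exponential, defined by its power series. -/
def mexp {d : Type*} [Fintype d] [DecidableEq d] (A : Matrix d d ℂ) : Matrix d d ℂ :=
  ∑' k : ℕ, ((k.factorial : ℂ))⁻¹ • A ^ k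

/-- The Hilbert space of `n` qubits is indexed by bit strings `Fin n → Fin 2`. -/
abbrev QMat (n : ℕ) := Matrix (Fin n → Fin 2) (Fin n → Fin 2) ℂ

def pauliX : Matrix (Fin 2) (Fin 2) ℂ := !![0, 1; 1, 0]
def pauliZ : Matrix (Fin 2) (Fin 2) ℂ := !![1, 0; 0, -1]
def hadamardMat : Matrix (Fin 2) (Fin 2) ℂ :=
  (((Real.sqrt 2 : ℝ) : ℂ))⁻¹ • !![1, 1; 1, -1]

/-- A single-qubit operator `A` acting on qubit `i` of `n` qubits. -/
def op1 {n : ℕ} (i : Fin n) (A : Matrix (Fin 2) (Fin 2) ℂ) : QMat n :=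
  Matrix.of fun x y =>
    A (x i) (y i) * ∏ j ∈ Finset.univ.erase i, (if x j = y j then (1 : ℂ) else 0)

/-- Pauli `X` on qubit `i`. -/
def Xop {n : ℕ} (i : Fin n) : QMat n := op1 i pauliX
/-- Pauli `Z` on qubit `i`. -/
def Zop {n : ℕ} (i : Fin n) : QMat n := op1 i pauliZ

/-- `ZXZ_i = Z_{i-1} X_i Z_{i+1}`, with the `Z` factors dropped at the boundary
(so `ZXZ_1 = X_1 Z_2` and `ZXZ_n = Z_{n-1} X_n`). -/
def ZXZop {n : ℕ} (i : Fin n) : QMat n :=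
  (if h : 0 < (i : ℕ) then Zop ⟨(i : ℕ) - 1, by have := i.isLt; omega⟩ else 1) *
    Xop i *
    (if h : (i : ℕ) + 1 < n then Zop ⟨(i : ℕ) + 1, h⟩ else 1)

/-- The gate `e^{iφ A}`. -/
def rotGate {n : ℕ} (φ : ℝ) (A : QMat n) : QMat n :=
  mexp ((Complex.I * (φ : ℂ)) • A)

/-- The controlled-Z gate `CZ_{i,i+1}`. -/
def czGate {n : ℕ} (i : ℕ) (h : i + 1 < n) : QMat n :=
  Matrix.of fun x y =>
    if x = y then (if x ⟨i, by omega⟩ = 1 ∧ x ⟨i + 1, h⟩ = 1 then (-1 : ℂ) else 1) else 0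

/-- `E = (∏ᵢ Hᵢ)(∏ᵢ CZ_{i,i+1})`. -/
def Egate (n : ℕ) : QMat n :=
  (List.ofFn fun i : Fin n => op1 i hadamardMat).prod *
    (List.ofFn fun i : Fin (n - 1) => czGate (i : ℕ) (by have := i.isLt; omega)).prod

/-- One layer `∏ᵢ e^{i bᵢ Zᵢ}` of diagonal gates. -/
def diagLayer {n : ℕ} (b : Fin n → ℝ) : QMat n :=
  (List.ofFn fun i : Fin n => rotGate (b i) (Zop i)).prod

/-- The circuit `U_β` with `k` layers: `(E·L_{k-1})·(E·L_{k-2})⋯(E·L_0)` where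
`L_j = ∏ᵢ e^{i βᵢʲ Zᵢ}`. -/
def circuitU (n : ℕ) {k : ℕ} (β : Fin k → Fin n → ℝ) : QMat n :=
  ((List.ofFn fun j : Fin k => Egate n * diagLayer (β j)).reverse).prod

/-- The uniform probability measure on the box `[0, 2π)^ι`. -/
def unifBox (ι : Type*) [Fintype ι] : Measure (ι → ℝ) :=
  (ENNReal.ofReal ((2 * Real.pi) ^ (Fintype.card ι)))⁻¹ •
    MeasureTheory.volume.restrict (Set.univ.pi fun _ => Set.Ico 0 (2 * Real.pi))

/-- The amplitude `⟨y| M |+ⁿ⟩ = 2^{-n/2} ∑_x M y x`. -/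
def ampPlus {n : ℕ} (M : QMat n) (y : Fin n → Fin 2) : ℂ :=
  (((Real.sqrt 2 : ℝ) : ℂ))⁻¹ ^ n * ∑ x : Fin n → Fin 2, M y x

/-- The tensor product `⨂ᵢ Bᵢ` of single-qubit operators. -/
def tensorOp {n : ℕ} : (Fin n → Matrix (Fin 2) (Fin 2) ℂ) →* QMat n where
  toFun B := Matrix.of fun x y => ∏ i, B i (x i) (y i)
  map_one' := by
    ext x y
    simp only [Matrix.of_apply, Pi.one_apply, Matrix.one_apply, Finset.prod_ite_zero,
      Finset.prod_const_one, Finset.mem_univ, true_implies, funext_iff]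
  map_mul' B C := by
    ext x y
    simp only [Matrix.of_apply, Pi.mul_apply, Matrix.mul_apply, ← Finset.prod_mul_distrib]
    rw [Finset.prod_univ_sum, Fintype.piFinset_univ]

theorem tensorOp_apply {n : ℕ} (B : Fin n → Matrix (Fin 2) (Fin 2) ℂ) (x y : Fin n → Fin 2) :
    tensorOp B x y = ∏ i, B i (x i) (y i) := rfl

theorem op1_eq_tensorOp {n : ℕ} (i : Fin n) (A : Matrix (Fin 2) (Fin 2) ℂ) :
    op1 i A = tensorOp (Pi.mulSingle i A) := by
  ext x y
  rw [tensorOp_apply, ← Finset.mul_prod_erase _ _ (Finset.mem_univ i), Pi.mulSingle_eq_same]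
  simp only [op1, Matrix.of_apply]
  congr 1
  refine Finset.prod_congr rfl fun j hj => ?_
  rw [Pi.mulSingle_eq_of_ne (Finset.ne_of_mem_erase hj), Matrix.one_apply]

theorem prod_map_mulSingle_apply {ι M : Type*} [DecidableEq ι] [Monoid M] (A : ι → M)
    {l : List ι} (hl : l.Nodup) (j : ι) :
    (l.map fun i => (Pi.mulSingle i (A i) : ι → M)).prod j = if j ∈ l then A j else 1 := by
  induction l with
  | nil => simp
  | cons a l ih =>
    rw [List.nodup_cons] at hl
    rw [List.map_cons, List.prod_cons, Pi.mul_apply, ih hl.2]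
    rcases eq_or_ne j a with rfl | h
    · simp [hl.1]
    · simp [h]

theorem prod_ofFn_op1 {n : ℕ} (A : Fin n → Matrix (Fin 2) (Fin 2) ℂ) :
    (List.ofFn fun i => op1 i (A i)).prod = tensorOp A := by
  have h : (List.ofFn fun i => op1 i (A i)) =
      ((List.finRange n).map fun i => Pi.mulSingle i (A i)).map tensorOp := by
    rw [List.ofFn_eq_map, List.map_map]
    exact List.map_congr_left fun i _ => op1_eq_tensorOp i (A i)
  rw [h, ← map_list_prod]
  congr 1
  ext1 j
  simp [prod_map_mulSingle_apply A (List.nodup_finRange n)]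

theorem exists_prod_czGate_eq_diagonal (n : ℕ) : ∃ d : (Fin n → Fin 2) → ℂ,
    (List.ofFn fun i : Fin (n - 1) =>
      czGate (n := n) (i : ℕ) (by have := i.isLt; omega)).prod = diagonal d := by
  suffices h : (List.ofFn fun i : Fin (n - 1) =>
      czGate (n := n) (i : ℕ) (by have := i.isLt; omega)).prod ∈
        (diagonalRingHom (Fin n → Fin 2) ℂ).range by
    obtain ⟨d, hd⟩ := h
    exact ⟨d, hd.symm⟩
  refine list_prod_mem fun M hM => ?_
  obtain ⟨i, rfl⟩ := List.mem_ofFn.1 hM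
  exact ⟨fun x => if x ⟨i, by omega⟩ = 1 ∧ x ⟨i + 1, by omega⟩ = 1 then -1 else 1, rfl⟩

/-- The eigenvalue `(-1)^a` of the Pauli matrix `Z`. -/
def zSign (a : Fin 2) : ℂ := if a = 1 then -1 else 1

theorem hadamardMat_apply (a b : Fin 2) :
    hadamardMat a b = (if a = 1 then zSign b else 1) * hadamardMat 0 b := by
  fin_cases a <;> fin_cases b <;> simp [hadamardMat, zSign]

theorem Egate_apply {n : ℕ} (y x : Fin n → Fin 2) :
    Egate n y x = (∏ i, if y i = 1 then zSign (x i) else 1) * Egate n (fun _ => 0) x := by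
  obtain ⟨d, hd⟩ := exists_prod_czGate_eq_diagonal n
  simp only [Egate, hd, prod_ofFn_op1, mul_diagonal, tensorOp_apply]
  rw [← mul_assoc, ← Finset.prod_mul_distrib]
  congr 1
  exact Finset.prod_congr rfl fun i _ => hadamardMat_apply _ _

theorem Zop_eq_diagonal {n : ℕ} (i : Fin n) :
    Zop i = diagonal fun x : Fin n → Fin 2 => zSign (x i) := by
  ext x y
  rw [Zop, op1, Matrix.of_apply, diagonal_apply]
  split_ifs with h
  · subst h
    generalize x i = a
    fin_cases a <;> simp [pauliZ, zSign]
  · obtain ⟨j, hj⟩ := Function.ne_iff.1 h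
    rcases eq_or_ne j i with rfl | hji
    · have : pauliZ (x j) (y j) = 0 := by
        generalize x j = a at *
        generalize y j = b at *
        fin_cases a <;> fin_cases b <;> simp_all [pauliZ]
      rw [this, zero_mul]
    · rw [Finset.prod_eq_zero (Finset.mem_erase.2 ⟨hji, Finset.mem_univ j⟩) (if_neg hj), mul_zero]

theorem mexp_diagonal {d : Type*} [Fintype d] [DecidableEq d] (v : d → ℂ) :
    mexp (diagonal v) = diagonal fun x => Complex.exp (v x) := by
  have h : mexp (diagonal v) = NormedSpace.exp (diagonal v) := by
    rw [NormedSpace.exp_eq_tsum ℂ]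
    rfl
  rw [h, Matrix.exp_diagonal]
  congr 1
  ext x
  rw [Pi.coe_exp, Complex.exp_eq_exp_ℂ]

theorem rotGate_Zop {n : ℕ} (φ : ℝ) (i : Fin n) :
    rotGate φ (Zop i) =
      diagonal fun x : Fin n → Fin 2 => Complex.exp (Complex.I * φ * zSign (x i)) := by
  rw [rotGate, Zop_eq_diagonal, ← diagonal_smul, mexp_diagonal]
  rfl

theorem diagLayer_eq_diagonal {n : ℕ} (b : Fin n → ℝ) :
    diagLayer b =
      diagonal fun x : Fin n → Fin 2 => ∏ i, Complex.exp (Complex.I * b i * zSign (x i)) := by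
  have h : (List.ofFn fun i : Fin n => rotGate (b i) (Zop i)) =
      (List.ofFn fun (i : Fin n) (x : Fin n → Fin 2) =>
        Complex.exp (Complex.I * b i * zSign (x i))).map (diagonalRingHom (Fin n → Fin 2) ℂ) := by
    rw [List.map_ofFn]
    congr 1
    ext1 i
    exact rotGate_Zop _ _
  rw [diagLayer, h, ← map_list_prod, List.prod_ofFn]
  simp only [diagonalRingHom_apply]
  congr 1
  ext x
  rw [Finset.prod_apply]

theorem continuous_circuitU (n k : ℕ) :
    Continuous fun β : Fin k → Fin n → ℝ => circuitU n β := by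
  simp only [circuitU, List.ofFn_eq_map, ← List.map_reverse]
  refine continuous_list_prod _ fun j _ => ?_
  simp only [diagLayer_eq_diagonal]
  refine continuous_const.mul (Continuous.matrix_diagonal ?_)
  fun_prop

/-- The translation `t ↦ t + π/2` modulo `2π` on `[0, 2π)`. -/
def quarterShift (t : ℝ) : ℝ := if t < 3 * π / 2 then t + π / 2 else t - 3 * π / 2

theorem measurePreserving_quarterShift :
    MeasurePreserving quarterShift (volume.restrict (Set.Ico 0 (2 * π)))
      (volume.restrict (Set.Ico 0 (2 * π))) := by
  have hπ := Real.pi_pos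
  have hm : Measurable quarterShift :=
    Measurable.ite measurableSet_Iio (measurable_id.add_const _) (measurable_id.sub_const _)
  refine ⟨hm, ?_⟩
  have key : ∀ a b c : ℝ, Set.EqOn quarterShift (· + c) (Set.Ico a b) →
      Measure.map quarterShift (volume.restrict (Set.Ico a b)) =
        volume.restrict (Set.Ico (a + c) (b + c)) := by
    intro a b c h
    have h' : quarterShift =ᵐ[volume.restrict (Set.Ico a b)] (· + c) :=
      (ae_restrict_iff' measurableSet_Ico).2 (Filter.Eventually.of_forall h)
    rw [Measure.map_congr h']
    have := ((measurePreserving_add_right volume c).restrict_preimage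
      (measurableSet_Ico (a := a + c) (b := b + c))).map_eq
    simpa using this
  have split : ∀ c : ℝ, 0 ≤ c → c ≤ 2 * π → volume.restrict (Set.Ico 0 (2 * π)) =
      volume.restrict (Set.Ico 0 c) + volume.restrict (Set.Ico c (2 * π)) := by
    intro c h0 h1
    rw [← Measure.restrict_union (Set.Ico_disjoint_Ico_same) measurableSet_Ico,
      Set.Ico_union_Ico_eq_Ico h0 h1]
  conv_lhs => rw [split (3 * π / 2) (by positivity) (by linarith)]
  rw [Measure.map_add _ _ hm, key 0 (3 * π / 2) (π / 2) fun t ht => if_pos ht.2,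
    key (3 * π / 2) (2 * π) (-(3 * π / 2)) fun t ht => by
      simp [quarterShift, not_lt.2 ht.1, sub_eq_add_neg],
    split (π / 2) (by positivity) (by linarith), add_comm]
  congr 3 <;> ring

theorem exp_quarterShift_mul_zSign (t : ℝ) (a : Fin 2) :
    Complex.exp (Complex.I * quarterShift t * zSign a) =
      Complex.I * zSign a * Complex.exp (Complex.I * t * zSign a) := by
  have h1 : Complex.exp (Complex.I * (π / 2)) = Complex.I := by
    rw [mul_comm, Complex.exp_pi_div_two_mul_I]
  have h2 : Complex.exp (-(Complex.I * (π / 2))) = -Complex.I := by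
    rw [Complex.exp_neg, h1, Complex.inv_I]
  unfold quarterShift zSign
  split_ifs
  · rw [show Complex.I * ((t + π / 2 : ℝ) : ℂ) * -1 = -(Complex.I * (π / 2)) +
      Complex.I * t * -1 by push_cast; ring, Complex.exp_add, h2]
    ring
  · rw [show Complex.I * ((t + π / 2 : ℝ) : ℂ) * 1 = Complex.I * (π / 2) +
      Complex.I * t * 1 by push_cast; ring, Complex.exp_add, h1]
    ring
  · rw [show Complex.I * ((t - 3 * π / 2 : ℝ) : ℂ) * -1 = -(Complex.I * (π / 2)) +
      Complex.I * t * -1 + 2 * π * Complex.I by push_cast; ring, Complex.exp_periodic,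
      Complex.exp_add, h2]
    ring
  · rw [show Complex.I * ((t - 3 * π / 2 : ℝ) : ℂ) * 1 = Complex.I * (π / 2) +
      Complex.I * t * 1 - 2 * π * Complex.I by push_cast; ring, Complex.exp_periodic.sub_eq,
      Complex.exp_add, h1]
    ring

/-- Shifting the angles of a layer by `π/2` on the support of `y` turns the row of `E` indexed by
`0ⁿ` into the row indexed by `y`, up to a phase. -/
theorem Egate_mul_diagLayer_quarterShift {n : ℕ} (y : Fin n → Fin 2) (b : Fin n → ℝ)
    (x : Fin n → Fin 2) :
    (Egate n * diagLayer fun i => (if y i = 1 then quarterShift else id) (b i)) (fun _ => 0) x =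
      (∏ i, if y i = 1 then Complex.I else 1) * (Egate n * diagLayer b) y x := by
  simp only [diagLayer_eq_diagonal, mul_diagonal]
  rw [Egate_apply y x, mul_comm (Egate n _ x), mul_right_comm, ← mul_assoc, ← mul_assoc,
    ← Finset.prod_mul_distrib, ← Finset.prod_mul_distrib]
  congr 1
  refine Finset.prod_congr rfl fun i _ => ?_
  split_ifs
  · rw [exp_quarterShift_mul_zSign]
  · simp

theorem circuitU_succ (n k : ℕ) (β : Fin (k + 1) → Fin n → ℝ) :
    circuitU n β = Egate n * diagLayer (β (Fin.last k)) * circuitU n fun j => β j.castSucc := by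
  rw [circuitU, List.ofFn_succ', List.concat_eq_append, List.reverse_append]
  simp only [List.reverse_singleton, List.singleton_append, List.prod_cons]
  rfl

/-- The coordinatewise shift of the angles in the last layer by `π/2` on the support of `y`. -/
def lastLayerShift {n k : ℕ} (y : Fin n → Fin 2) (p : Fin (k + 1) × Fin n) : ℝ → ℝ :=
  if p.1 = Fin.last k then (if y p.2 = 1 then quarterShift else id) else id

theorem normSq_ampPlus_circuitU_lastLayerShift {n k : ℕ} (y : Fin n → Fin 2)
    (β : Fin (k + 1) × Fin n → ℝ) :
    Complex.normSq (ampPlus (circuitU n fun j i => lastLayerShift y (j, i) (β (j, i)))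
      fun _ => 0) =
    Complex.normSq (ampPlus (circuitU n fun j i => β (j, i)) y) := by
  set c : ℂ := ∏ i, if y i = 1 then Complex.I else 1
  have hc : Complex.normSq c = 1 := by
    rw [map_prod]
    refine Finset.prod_eq_one fun i _ => ?_
    split_ifs <;> simp
  have hrow : ∀ x, circuitU n (fun j i => lastLayerShift y (j, i) (β (j, i))) (fun _ => 0) x =
      c * circuitU n (fun j i => β (j, i)) y x := by
    intro x
    simp only [circuitU_succ, lastLayerShift, Fin.castSucc_ne_last, if_true, if_false, id]
    rw [Matrix.mul_apply, Matrix.mul_apply, Finset.mul_sum]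
    refine Finset.sum_congr rfl fun z _ => ?_
    rw [← mul_assoc]
    congr 1
    exact Egate_mul_diagLayer_quarterShift y (fun i => β (Fin.last k, i)) z
  simp only [ampPlus, hrow, ← Finset.mul_sum]
  rw [mul_left_comm, map_mul, hc, one_mul]

theorem measurePreserving_unifBox {ι : Type*} [Fintype ι] {g : ι → ℝ → ℝ}
    (hg : ∀ i, MeasurePreserving (g i) (volume.restrict (Set.Ico 0 (2 * π)))
      (volume.restrict (Set.Ico 0 (2 * π)))) :
    MeasurePreserving (fun β : ι → ℝ => fun i => g i (β i)) (unifBox ι) (unifBox ι) := by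
  have h : volume.restrict (Set.univ.pi fun _ : ι => Set.Ico 0 (2 * π)) =
      Measure.pi fun _ : ι => volume.restrict (Set.Ico 0 (2 * π)) := by
    rw [volume_pi, Measure.restrict_pi_pi]
  unfold unifBox
  rw [h]
  exact (measurePreserving_pi _ _ hg).smul_measure _

/-- **Hiding property:** for every output string `y`, the random variable
`β ↦ |⟨y|U_β^m|+ⁿ⟩|²` (with all angles independent and uniform on `[0,2π)`) has the
same distribution as `β ↦ |⟨0ⁿ|U_β^m|+ⁿ⟩|²`. -/
theorem hiding_property (n m : ℕ) (hn : 2 ≤ n) (hm : 2 ≤ m) (y : Fin n → Fin 2) :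
    Measure.map (fun β : Fin (m - 1) × Fin n → ℝ =>
        Complex.normSq (ampPlus (circuitU n fun j i => β (j, i)) y))
      (unifBox (Fin (m - 1) × Fin n)) =
    Measure.map (fun β : Fin (m - 1) × Fin n → ℝ =>
        Complex.normSq (ampPlus (circuitU n fun j i => β (j, i)) (fun _ => 0)))
      (unifBox (Fin (m - 1) × Fin n)) := by
  obtain ⟨k, hk⟩ : ∃ k, m - 1 = k + 1 := ⟨m - 2, by omega⟩
  rw [hk]
  have hT : MeasurePreserving (fun (β : Fin (k + 1) × Fin n → ℝ) p => lastLayerShift y p (β p))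
      (unifBox (Fin (k + 1) × Fin n)) (unifBox (Fin (k + 1) × Fin n)) := by
    refine measurePreserving_unifBox fun p => ?_
    unfold lastLayerShift
    split_ifs
    exacts [measurePreserving_quarterShift, MeasurePreserving.id _, MeasurePreserving.id _]
  have hf : Continuous fun β : Fin (k + 1) × Fin n → ℝ =>
      Complex.normSq (ampPlus (circuitU n fun j i => β (j, i)) fun _ => 0) := by
    have hU : Continuous fun β : Fin (k + 1) × Fin n → ℝ => circuitU n fun j i => β (j, i) :=
      (continuous_circuitU n (k + 1)).comp (by fun_prop)
    exact Complex.continuous_normSq.comp (continuous_const.mul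
      (continuous_finsetSum _ fun x _ => hU.matrix_elem _ _))
  rw [← (funext (normSq_ampPlus_circuitU_lastLayerShift y) :)]
  exact (Measure.map_map hf.measurable hT.measurable).symm.trans
    (congrArg (Measure.map _) hT.map_eq)
end
end
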